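/- The Hausdorff dimension of the intersection of the set difference M \ L (Markov spectrum minus Lagrange spectrum) with the open interval (c_inf, C_inf) is strictly greater than 0.2628. -/

import Mathlib

open Filter Set

/-- Convergents of the continued fraction `[a 0; a 1, a 2, ...]`. -/
noncomputable def cfConv : (ℕ → ℕ) → ℕ → ℝ
  | a, 0 => (a 0 : ℝ)
  | a, n + 1 => (a 0 : ℝ) + 1 / cfConv (fun i => a (i + 1)) n

/-- Value of the infinite continued fraction `[a 0; a 1, a 2, ...]`,
i.e. the limit of its convergents. -/
noncomputable def cfVal (a : ℕ → ℕ) : ℝ := limUnder atTop (cfConv a)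

/-- Value of the infinite continued fraction `[0; g 0, g 1, g 2, ...]`. -/
noncomputable def cf0 (g : ℕ → ℕ) : ℝ :=
  cfVal (fun n => match n with | 0 => 0 | k + 1 => g k)

/-- `λ_i(A) = [a_i; a_{i+1}, ...] + [0; a_{i-1}, a_{i-2}, ...]` for a bi-infinite
sequence `A`. -/
noncomputable def lam (A : ℤ → ℕ) (i : ℤ) : ℝ :=
  cfVal (fun n => A (i + n)) + cf0 (fun k => A (i - 1 - k))

/-- The Markov value `m(A) = sup_i λ_i(A)`. -/
noncomputable def markovVal (A : ℤ → ℕ) : ℝ := sSup (Set.range (lam A))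

/-- The Lagrange value `ℓ(A) = limsup_{i → +∞} λ_i(A)`. -/
noncomputable def lagrangeVal (A : ℤ → ℕ) : ℝ := limsup (lam A) atTop

/-- The Markov spectrum (Perron's characterization). -/
def MarkovSpectrum : Set ℝ :=
  {x | ∃ A : ℤ → ℕ, (∀ n, 0 < A n) ∧ BddAbove (Set.range (lam A)) ∧ x = markovVal A}

/-- The Lagrange spectrum (Perron's characterization). -/
def LagrangeSpectrum : Set ℝ :=
  {x | ∃ A : ℤ → ℕ, (∀ n, 0 < A n) ∧ IsBoundedUnder (· ≤ ·) atTop (lam A) ∧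
    x = lagrangeVal A}

/-- The purely periodic one-sided sequence with period `w`. -/
def perSeq (w : List ℕ) : ℕ → ℕ := fun n => w.getD (n % w.length) 1

/-- The one-sided sequence beginning with the finite word `p` and continuing with `g`. -/
def catSeq (p : List ℕ) (g : ℕ → ℕ) : ℕ → ℕ :=
  fun n => if n < p.length then p.getD n 1 else g (n - p.length)

/-- The eventually periodic one-sided sequence with preperiod `p` and period `w`. -/
def prePer (p w : List ℕ) : ℕ → ℕ := catSeq p (perSeq w)

/-- The periodic bi-infinite sequence with period `w`. -/
def perZ (w : List ℕ) : ℤ → ℕ := fun n => w.getD ((n % (w.length : ℤ)).toNat) 1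

/-- `c_∞ = [overline(2_4 1_2 2_2 1)] + [0; overline(1 2_2 1_2 2_4)]`. -/
noncomputable def cInf : ℝ :=
  cfVal (perSeq [2,2,2,2,1,1,2,2,1]) + cf0 (perSeq [1,2,2,1,1,2,2,2,2])

/-- `C_∞ = [2; 1, 2_2, 1_2, 2_4, 1, 2_2, 1_2, 2_4, 1, 2_2, 1_2, 2_2, 1, 2_4, 1_2,
overline(2_3 1_3)] + [0; 2_3, 1_2, 2_2, 1, 2_4, 1, overline(1_3 2_3)]`. -/
noncomputable def CInf : ℝ :=
  cfVal (prePer [2,1,2,2,1,1,2,2,2,2,1,2,2,1,1,2,2,2,2,1,2,2,1,1,2,2,1,2,2,2,2,1,1]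
    [2,2,2,1,1,1]) +
  cf0 (prePer [2,2,2,1,1,2,2,1,2,2,2,2,1] [1,1,1,2,2,2])

/-- `f = [overline(2_4 1_2 2_2 1)] + [0; 1, 2_2, 1_2, 2_4, 1, 2_2, 1_2, 2_2, 1_2,
overline(2_3 1_3)]`. -/
noncomputable def fV : ℝ :=
  cfVal (perSeq [2,2,2,2,1,1,2,2,1]) +
  cf0 (prePer [1,2,2,1,1,2,2,2,2,1,2,2,1,1,2,2,1,1] [2,2,2,1,1,1])

/-- `w` occurs in the bi-infinite sequence `A` starting at position `j`. -/
def occursAtZ (w : List ℕ) (A : ℤ → ℕ) (j : ℤ) : Prop :=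
  ∀ i : ℕ, i < w.length → A (j + i) = w.getD i 0

/-- `w` occurs somewhere in the bi-infinite sequence `A`. -/
def occursInZ (w : List ℕ) (A : ℤ → ℕ) : Prop := ∃ j : ℤ, occursAtZ w A j

/-- `w` occurs in the one-sided sequence `g` starting at position `k`. -/
def occursAtN (w : List ℕ) (g : ℕ → ℕ) (k : ℕ) : Prop :=
  ∀ i : ℕ, i < w.length → g (k + i) = w.getD i 0

/-- `w` occurs somewhere in the one-sided sequence `g`. -/
def occursInN (w : List ℕ) (g : ℕ → ℕ) : Prop := ∃ k : ℕ, occursAtN w g k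

def W1 : List ℕ := [1,2,1]
def W2 : List ℕ := [2,2,1,2,2,2,1]
def W3 : List ℕ := [2,2,2,1,2,2,2]
def W4 : List ℕ := [2,2,2,2,2,1,2,2,1,1]
def W5 : List ℕ := [2,2,2,1,1,2,2,2,2,1,2,2,1,1,2,2,2]
def W6 : List ℕ := [2,2,1,1,2,2,2,2,1,2,2,1,1,2,2,2,1]
def W7 : List ℕ := [1,1,2,2,1,1,2,2,2,2,1,2,2,1,1,2,2,2]
def W8 : List ℕ := [2,2,1,2,2,1,1,2,2,2,2,1,2,2,1,1,2,2,2,2,2]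
def W9 : List ℕ := [1,2,2,1,2,2,1,1,2,2,2,2,1,2,2,1,1,2,2,2,2,1]
def W10 : List ℕ := [2,2,2,2,1,2,2,1,1,2,2,2,2,1,2,2,1,1,2,2,2,2,1,1]
def W11 : List ℕ := [2,2,2,2,1,2,2,1,1,2,2,2,2,1,2,2,1,1,2,2,2,2,1,2,2,1,2]
def W12 : List ℕ := [1,2,2,2,2,1,2,2,1,1,2,2,2,2,1,2,2,1,1,2,2,2,2,1,2,2,1,1,1]
def W13 : List ℕ := [2,1,2,2,2,2,1,2,2,1,1,2,2,2,2,1,2,2,1,1,2,2,2,2,1,2,2,1,1,2,2]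

/-- The list of the thirteen words `W_1, …, W_13`. -/
def Wall : List (List ℕ) := [W1,W2,W3,W4,W5,W6,W7,W8,W9,W10,W11,W12,W13]

/-- The words `W_1, …, W_13` together with the (0-based) position of their marked
digit `2^*`. -/
def markedW : List (List ℕ × ℕ) :=
  [(W1,1),(W2,3),(W3,4),(W4,4),(W5,8),(W6,7),(W7,9),(W8,10),(W9,11),(W10,12),
   (W11,12),(W12,13),(W13,14)]

/-- The words `V_15, …, V_21` together with the (0-based) position of their marked
digit `2^*`. -/
def markedV : List (List ℕ × ℕ) :=
  [([1,1,2,2],2),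
   ([2,2,1,2,2,1],3),
   ([2,2,2,2,1,2,2,1,2],3),
   ([1,2,2,2,2,1,2,2,1,1,1],4),
   ([1,2,2,2,2,1,2,2,1,1,2,2,1],4),
   ([2,1,2,2,2,2,1,2,2,1,1,2,2,2],5),
   ([1,1,1,2,2,2,2,1,2,2,1,1,2,2,2],6)]

/-- The word `2 1_2 2_4 1 2_2 1_2 2_3`. -/
def spWord : List ℕ := [2,1,1,2,2,2,2,1,2,2,1,1,2,2,2]

/-- The set `P` of 27 forbidden words: `W_1, …, W_13`, their transposes, and
`2 1_2 2_4 1 2_2 1_2 2_3` together with its transpose. -/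
def Pwords : List (List ℕ) := Wall ++ Wall.map List.reverse ++ [spWord, spWord.reverse]

/-- `g` contains no word of `P` as a consecutive subword. -/
def avoidsP (g : ℕ → ℕ) : Prop := ∀ w ∈ Pwords, ¬ occursInN w g

/-- The Cantor set `Y`. -/
noncomputable def Yset : Set ℝ :=
  {x | ∃ g : ℕ → ℕ, (∀ n, g n = 1 ∨ g n = 2) ∧ avoidsP g ∧ x = cf0 g}

/-- The word `1_2 2_4 1 2_2 1_2 2_4 1 2_2 1_2 2_4 1 2_2 1_2 2_2`. -/
def bigWord : List ℕ :=
  [1,1,2,2,2,2,1,2,2,1,1,2,2,2,2,1,2,2,1,1,2,2,2,2,1,2,2,1,1,2,2]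

/-- The word `1_3 2_4 1 2_2 1_2 2_4 1 2_2 1_2 2_4 1 2_2 1_2 2_2`. -/
def bigWord13 : List ℕ := 1 :: bigWord

/-- `g` is an infinite concatenation of the blocks `(1,1)` and `(2,2)`. -/
def isBlockSeq (g : ℕ → ℕ) : Prop :=
  ∀ n, (g (2*n) = 1 ∧ g (2*n+1) = 1) ∨ (g (2*n) = 2 ∧ g (2*n+1) = 2)

/-- The Gauss–Cantor set `K({1_2, 2_2})`. -/
noncomputable def Kset : Set ℝ := {x | ∃ g : ℕ → ℕ, isBlockSeq g ∧ x = cf0 g}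

open Topology

theorem one_le_cfConv {a : ℕ → ℕ} (ha : ∀ n, 0 < a n) (n : ℕ) : 1 ≤ cfConv a n := by
  have h0 : ∀ a : ℕ → ℕ, (∀ n, 0 < a n) → (1 : ℝ) ≤ a 0 := fun a ha => by exact_mod_cast ha 0
  induction n generalizing a with
  | zero => simpa [cfConv] using h0 a ha
  | succ n ih =>
    have h := ih (a := fun i => a (i + 1)) (fun i => ha _)
    have h' : 0 ≤ 1 / cfConv (fun i => a (i + 1)) n := by positivity
    simp only [cfConv]
    linarith [h0 a ha]

theorem cfConv_mem {a : ℕ → ℕ} (ha : ∀ n, 0 < a n) (n : ℕ) :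
    (a 0 : ℝ) ≤ cfConv a n ∧ cfConv a n ≤ a 0 + 1 := by
  cases n with
  | zero => simp [cfConv]
  | succ n =>
    have h := one_le_cfConv (a := fun i => a (i + 1)) (fun i => ha _) n
    have h' : 0 ≤ 1 / cfConv (fun i => a (i + 1)) n := by positivity
    have h'' : 1 / cfConv (fun i => a (i + 1)) n ≤ 1 := by
      rw [div_le_one (by linarith)]; exact h
    simp only [cfConv]
    constructor <;> linarith

/-- Two continued fraction steps contract distances by a factor of at least four. -/
theorem abs_two_step_le {a b : ℝ} {x y : ℝ} (hb : 1 ≤ b) (hx : 1 ≤ x) (hy : 1 ≤ y) :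
    |(a + 1 / (b + 1 / x)) - (a + 1 / (b + 1 / y))| ≤ |x - y| / 4 := by
  have h1 : 2 ≤ b * x + 1 := by nlinarith
  have h2 : 2 ≤ b * y + 1 := by nlinarith
  have h : (a + 1 / (b + 1 / x)) - (a + 1 / (b + 1 / y)) =
      (x - y) / ((b * x + 1) * (b * y + 1)) := by
    have : b * x + 1 ≠ 0 := by positivity
    have : b * y + 1 ≠ 0 := by positivity
    have hx0 : x ≠ 0 := by positivity
    have hy0 : y ≠ 0 := by positivity
    have e1 : b + 1 / x = (b * x + 1) / x := by field_simp
    have e2 : b + 1 / y = (b * y + 1) / y := by field_simp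
    rw [e1, e2]
    field_simp
    ring
  rw [h, abs_div, abs_of_pos (show 0 < (b * x + 1) * (b * y + 1) by positivity)]
  apply div_le_div_of_nonneg_left (abs_nonneg _) (by norm_num)
  nlinarith

theorem abs_cfConv_sub_le (k : ℕ) : ∀ {a : ℕ → ℕ}, (∀ n, 0 < a n) → ∀ m n, 2 * k ≤ m →
    2 * k ≤ n → |cfConv a m - cfConv a n| ≤ (1 / 4) ^ k := by
  induction k with
  | zero =>
    intro a ha m n _ _
    have h1 := cfConv_mem ha m
    have h2 := cfConv_mem ha n
    rw [abs_le]
    constructor <;> linarith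
  | succ k ih =>
    intro a ha m n hm hn
    obtain ⟨m, rfl⟩ : ∃ m', m = m' + 1 + 1 := ⟨m - 2, by omega⟩
    obtain ⟨n, rfl⟩ : ∃ n', n = n' + 1 + 1 := ⟨n - 2, by omega⟩
    have ht : ∀ i, 0 < a (i + 1 + 1) := fun i => ha _
    have h1 := ih (a := fun i => a (i + 1 + 1)) ht m n (by omega) (by omega)
    have h2 := abs_two_step_le (a := a 0) (b := a 1) (by exact_mod_cast ha 1)
      (one_le_cfConv ht m) (one_le_cfConv ht n)
    simp only [cfConv, zero_add]
    rw [pow_succ]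
    linarith

theorem tendsto_cfConv {a : ℕ → ℕ} (ha : ∀ n, 0 < a n) :
    Tendsto (cfConv a) atTop (𝓝 (cfVal a)) := by
  have hc : CauchySeq (cfConv a) := by
    rw [Metric.cauchySeq_iff]
    intro ε hε
    obtain ⟨k, hk⟩ := exists_pow_lt_of_lt_one hε (by norm_num : (1 / 4 : ℝ) < 1)
    exact ⟨2 * k, fun m hm n hn => lt_of_le_of_lt (abs_cfConv_sub_le k ha m n hm hn) hk⟩
  obtain ⟨x, hx⟩ := cauchySeq_tendsto_of_complete hc
  rw [cfVal, hx.limUnder_eq]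
  exact hx

theorem one_le_cfVal {a : ℕ → ℕ} (ha : ∀ n, 0 < a n) : 1 ≤ cfVal a :=
  ge_of_tendsto' (tendsto_cfConv ha) (one_le_cfConv ha)

theorem cf0_eq_inv {g : ℕ → ℕ} (hg : ∀ n, 0 < g n) : cf0 g = 1 / cfVal g := by
  have h1 : Tendsto (fun n => 1 / cfConv g n) atTop (𝓝 (1 / cfVal g)) :=
    tendsto_const_nhds.div (tendsto_cfConv hg) (by linarith [one_le_cfVal hg])
  rw [cf0, cfVal]
  apply Tendsto.limUnder_eq
  rw [← tendsto_add_atTop_iff_nat 1]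
  refine h1.congr fun n => ?_
  simp [cfConv]

theorem cfVal_eq {a : ℕ → ℕ} (ha : ∀ n, 0 < a n) :
    cfVal a = a 0 + cf0 (fun n => a (n + 1)) := by
  have ht : ∀ i, 0 < a (i + 1) := fun i => ha _
  rw [cf0_eq_inv ht]
  have h1 : Tendsto (fun n => (a 0 : ℝ) + 1 / cfConv (fun n => a (n + 1)) n) atTop
      (𝓝 (a 0 + 1 / cfVal (fun n => a (n + 1)))) :=
    tendsto_const_nhds.add
      (tendsto_const_nhds.div (tendsto_cfConv ht) (by linarith [one_le_cfVal ht]))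
  exact tendsto_nhds_unique ((tendsto_add_atTop_iff_nat 1).2 (tendsto_cfConv ha)) h1

theorem cf0_eq {g : ℕ → ℕ} (hg : ∀ n, 0 < g n) :
    cf0 g = 1 / (g 0 + cf0 (fun n => g (n + 1))) := by
  rw [cf0_eq_inv hg, cfVal_eq hg]

theorem cf0_nonneg {g : ℕ → ℕ} (hg : ∀ n, 0 < g n) : 0 ≤ cf0 g := by
  have := one_le_cfVal hg
  rw [cf0_eq_inv hg]
  positivity

theorem cf0_le_one {g : ℕ → ℕ} (hg : ∀ n, 0 < g n) : cf0 g ≤ 1 := by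
  have := one_le_cfVal hg
  rw [cf0_eq_inv hg, div_le_one (by linarith)]
  exact this

theorem lam_eq {A : ℤ → ℕ} (hA : ∀ n, 0 < A n) (i : ℤ) :
    lam A i = A i + cf0 (fun n => A (i + 1 + n)) + cf0 (fun k => A (i - 1 - k)) := by
  rw [lam, cfVal_eq fun n => hA _]
  have : (fun n : ℕ => A (i + ((n + 1 : ℕ) : ℤ))) = fun n : ℕ => A (i + 1 + n) := by
    funext n; congr 1; push_cast; ring
  rw [this]
  simp

/-- Continued fractions sharing their first `2 k` digits are exponentially close. -/
theorem abs_cf0_sub_le (k : ℕ) : ∀ {g h : ℕ → ℕ}, (∀ n, 0 < g n) → (∀ n, 0 < h n) →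
    (∀ n < 2 * k, g n = h n) → |cf0 g - cf0 h| ≤ (1 / 4) ^ k := by
  induction k with
  | zero =>
    intro g h hg hh _
    rw [pow_zero, abs_le]
    constructor <;> linarith [cf0_nonneg hg, cf0_nonneg hh, cf0_le_one hg, cf0_le_one hh]
  | succ k ih =>
    intro g h hg hh hgh
    have e0 := hgh 0 (by omega)
    have e1 := hgh 1 (by omega)
    have hg' : ∀ i, 0 < g (i + 1 + 1) := fun i => hg _
    have hh' : ∀ i, 0 < h (i + 1 + 1) := fun i => hh _
    have h1 := ih hg' hh' fun n hn => hgh _ (by omega)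
    rw [cf0_eq hg, cf0_eq hh, cf0_eq (g := fun n => g (n + 1)) fun i => hg _,
      cf0_eq (g := fun n => h (n + 1)) fun i => hh _]
    simp only [zero_add, e0, e1]
    have b0 : (1 : ℝ) ≤ h 0 := by exact_mod_cast hh 0
    have b1 : (1 : ℝ) ≤ h 1 := by exact_mod_cast hh 1
    have p1 := cf0_nonneg hg'
    have p2 := cf0_nonneg hh'
    set x := cf0 fun n => g (n + 1 + 1)
    set y := cf0 fun n => h (n + 1 + 1)
    have d1 : 2 ≤ (h 0 : ℝ) * (h 1 + x) + 1 := by nlinarith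
    have d2 : 2 ≤ (h 0 : ℝ) * (h 1 + y) + 1 := by nlinarith
    have e : 1 / ((h 0 : ℝ) + 1 / (h 1 + x)) - 1 / (h 0 + 1 / (h 1 + y)) =
        (x - y) / ((h 0 * (h 1 + x) + 1) * (h 0 * (h 1 + y) + 1)) := by
      have q1 : (h 1 : ℝ) + x ≠ 0 := by positivity
      have q2 : (h 1 : ℝ) + y ≠ 0 := by positivity
      have q3 : (h 0 : ℝ) * (h 1 + x) + 1 ≠ 0 := by positivity
      have q4 : (h 0 : ℝ) * (h 1 + y) + 1 ≠ 0 := by positivity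
      have r1 : (h 0 : ℝ) + 1 / (h 1 + x) = (h 0 * (h 1 + x) + 1) / (h 1 + x) := by field_simp
      have r2 : (h 0 : ℝ) + 1 / (h 1 + y) = (h 0 * (h 1 + y) + 1) / (h 1 + y) := by field_simp
      rw [r1, r2]
      field_simp
      ring
    rw [e, abs_div, abs_of_pos (show (0 : ℝ) < _ * _ by positivity), pow_succ]
    calc |x - y| / ((h 0 * (h 1 + x) + 1) * (h 0 * (h 1 + y) + 1)) ≤ |x - y| / 4 :=
          div_le_div_of_nonneg_left (abs_nonneg _) (by norm_num) (by nlinarith)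
      _ ≤ _ := by linarith

theorem cf0_mem_of_one_two {g : ℕ → ℕ} (hg : ∀ n, g n = 1 ∨ g n = 2) :
    4 / 11 ≤ cf0 g ∧ cf0 g ≤ 11 / 15 := by
  have step : ∀ lo hi : ℝ, 0 ≤ lo → (∀ h : ℕ → ℕ, (∀ n, h n = 1 ∨ h n = 2) →
      lo ≤ cf0 h ∧ cf0 h ≤ hi) → ∀ h : ℕ → ℕ, (∀ n, h n = 1 ∨ h n = 2) →
      1 / (2 + hi) ≤ cf0 h ∧ cf0 h ≤ 1 / (1 + lo) := by
    intro lo hi hlo H h hh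
    obtain ⟨h1, h2⟩ := H (fun n => h (n + 1)) fun n => hh _
    have hpos : ∀ n, 0 < h n := fun n => by rcases hh n with e | e <;> omega
    rw [cf0_eq hpos]
    have h3 : (1 : ℝ) ≤ h 0 ∧ (h 0 : ℝ) ≤ 2 := by
      rcases hh 0 with e | e <;> rw [e] <;> norm_num
    constructor <;> apply one_div_le_one_div_of_le <;> linarith
  have b0 : ∀ h : ℕ → ℕ, (∀ n, h n = 1 ∨ h n = 2) → (0 : ℝ) ≤ cf0 h ∧ cf0 h ≤ 1 := by
    intro h hh
    have hpos : ∀ n, 0 < h n := fun n => by rcases hh n with e | e <;> omega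
    exact ⟨cf0_nonneg hpos, cf0_le_one hpos⟩
  have b1 := step _ _ (by norm_num) b0
  have b2 := step _ _ (by norm_num) b1
  have b3 := step _ _ (by norm_num) b2
  have b4 := step _ _ (by norm_num) b3
  have h3 := b3 g hg
  have h4 := b4 g hg
  norm_num at h3 h4 ⊢
  exact ⟨by linarith [h3.1], by linarith [h4.2]⟩

/-- Lower and upper bounds, as pairs (numerator, denominator), for `[0; w, g]`, where `g` is any
sequence of digits in `{1, 2}`. -/
def cfBounds : List ℕ → (ℕ × ℕ) × (ℕ × ℕ)
  | [] => ((4, 11), (11, 15))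
  | a :: w =>
    let b := cfBounds w
    ((b.2.2, a * b.2.2 + b.2.1), (b.1.2, a * b.1.2 + b.1.1))

theorem cfBounds_spec (w : List ℕ) {g : ℕ → ℕ} (hg : ∀ n, g n = 1 ∨ g n = 2)
    (hw : ∀ i < w.length, g i = w.getD i 0) :
    0 < (cfBounds w).1.2 ∧ 0 < (cfBounds w).2.2 ∧
      ((cfBounds w).1.1 : ℝ) / (cfBounds w).1.2 ≤ cf0 g ∧
      cf0 g ≤ ((cfBounds w).2.1 : ℝ) / (cfBounds w).2.2 := by
  induction w generalizing g with
  | nil => have := cf0_mem_of_one_two hg; norm_num [cfBounds]; exact this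
  | cons a w ih =>
    have ha : g 0 = a := by simpa using hw 0 (by simp)
    obtain ⟨h1, h2, h3, h4⟩ := ih (g := fun n => g (n + 1)) (fun n => hg _) (fun i hi => by
      simpa using hw (i + 1) (by simpa using hi))
    have hpos : ∀ n, 0 < g n := fun n => by rcases hg n with e | e <;> omega
    have ha0 : 0 < a := ha ▸ hpos 0
    have ha1 : (0 : ℝ) < a := by exact_mod_cast ha0
    have h0 : 0 ≤ cf0 (fun n => g (n + 1)) := cf0_nonneg fun n => hpos _
    rw [cf0_eq hpos, ha]
    simp only [cfBounds]
    set lo := (cfBounds w).1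
    set hi := (cfBounds w).2
    have h1' : (0 : ℝ) < lo.2 := by exact_mod_cast h1
    have h2' : (0 : ℝ) < hi.2 := by exact_mod_cast h2
    refine ⟨by positivity, by positivity, ?_, ?_⟩
    · have e : (hi.2 : ℝ) / ((a * hi.2 + hi.1 : ℕ) : ℝ) = 1 / (a + hi.1 / hi.2) := by
        push_cast; field_simp
      rw [e]
      exact one_div_le_one_div_of_le (by positivity) (by linarith)
    · have e : (lo.2 : ℝ) / ((a * lo.2 + lo.1 : ℕ) : ℝ) = 1 / (a + lo.1 / lo.2) := by
        push_cast; field_simp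
      rw [e]
      exact one_div_le_one_div_of_le (by positivity) (by linarith)

/-- `N / D` exceeds every value of `λ` at position `m` of an occurrence of `W`, for digits
in `{1, 2}`. -/
def lamLt (W : List ℕ) (m N D : ℕ) : Bool :=
  let r := (cfBounds (W.drop (m + 1))).2
  let l := (cfBounds (W.take m).reverse).2
  decide (D * (W.getD m 0 * (r.2 * l.2) + r.1 * l.2 + l.1 * r.2) < N * (r.2 * l.2))

/-- `N / D` is smaller than every value of `λ` at position `m` of an occurrence of `W`, for digits
in `{1, 2}`. -/
def lamGt (W : List ℕ) (m N D : ℕ) : Bool :=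
  let r := (cfBounds (W.drop (m + 1))).1
  let l := (cfBounds (W.take m).reverse).1
  decide (N * (r.2 * l.2) < D * (W.getD m 0 * (r.2 * l.2) + r.1 * l.2 + l.1 * r.2))

theorem occursAtZ.eq {W : List ℕ} {A : ℤ → ℕ} {j : ℤ} (h : occursAtZ W A j) {k : ℤ} (m : ℕ)
    (hm : m < W.length) (hk : k = j + m) : A k = W.getD m 0 := hk ▸ h m hm

theorem lam_bounds {A : ℤ → ℕ} (hA : ∀ n, A n = 1 ∨ A n = 2) {W : List ℕ} {m : ℕ} {i : ℤ}
    (hW : occursAtZ W A (i - m)) (hm : m < W.length) :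
    (0 < (cfBounds (W.drop (m + 1))).1.2 ∧ 0 < (cfBounds (W.drop (m + 1))).2.2 ∧
    0 < (cfBounds (W.take m).reverse).1.2 ∧ 0 < (cfBounds (W.take m).reverse).2.2) ∧
    (W.getD m 0 : ℝ) + (cfBounds (W.drop (m + 1))).1.1 / (cfBounds (W.drop (m + 1))).1.2 +
      (cfBounds (W.take m).reverse).1.1 / (cfBounds (W.take m).reverse).1.2 ≤ lam A i ∧
    lam A i ≤ (W.getD m 0 : ℝ) +
      (cfBounds (W.drop (m + 1))).2.1 / (cfBounds (W.drop (m + 1))).2.2 +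
      (cfBounds (W.take m).reverse).2.1 / (cfBounds (W.take m).reverse).2.2 := by
  have hpos : ∀ n, 0 < A n := fun n => by rcases hA n with e | e <;> omega
  obtain ⟨r1, r2, r3, r4⟩ := cfBounds_spec (W.drop (m + 1)) (g := fun n => A (i + 1 + n))
    (fun n => hA _) (fun k hk => by
      rw [List.length_drop] at hk
      rw [hW.eq (m + 1 + k) (by omega) (by push_cast; ring)]
      simp [List.getD_eq_getElem?_getD])
  obtain ⟨l1, l2, l3, l4⟩ := cfBounds_spec (W.take m).reverse (g := fun k => A (i - 1 - k))
    (fun n => hA _) (fun k hk => by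
      rw [List.length_reverse, List.length_take] at hk
      rw [hW.eq (m - 1 - k) (by omega) (by omega)]
      rw [List.getD_eq_getElem?_getD, List.getD_eq_getElem?_getD, List.getElem?_reverse (by
        rw [List.length_take]; omega), List.length_take, List.getElem?_take, if_pos (by omega)]
      congr 3; omega)
  rw [lam_eq hpos, hW.eq m hm (by ring)]
  exact ⟨⟨r1, r2, l1, l2⟩, by linarith, by linarith⟩

theorem lam_lt_of_lamLt {A : ℤ → ℕ} (hA : ∀ n, A n = 1 ∨ A n = 2) {W : List ℕ} {m : ℕ} {i : ℤ}
    (hW : occursAtZ W A (i - m)) (hm : m < W.length)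
    {N D : ℕ} (hD : 0 < D) (h : lamLt W m N D = true) :
    lam A i < N / D := by
  obtain ⟨⟨-, r2, -, l2⟩, -, h2⟩ := lam_bounds hA hW hm
  simp only [lamLt, decide_eq_true_eq] at h
  set r := (cfBounds (W.drop (m + 1))).2
  set l := (cfBounds (W.take m).reverse).2
  have h' : (D : ℝ) * (W.getD m 0 * (r.2 * l.2) + r.1 * l.2 + l.1 * r.2) < N * (r.2 * l.2) := by
    exact_mod_cast h
  have r2' : (0 : ℝ) < r.2 := by exact_mod_cast r2
  have l2' : (0 : ℝ) < l.2 := by exact_mod_cast l2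
  have hD' : (0 : ℝ) < D := by exact_mod_cast hD
  refine h2.trans_lt ?_
  rw [lt_div_iff₀ hD', ← mul_lt_mul_iff_left₀ (mul_pos r2' l2')]
  refine lt_of_eq_of_lt ?_ h'
  field_simp

theorem lt_lam_of_lamGt {A : ℤ → ℕ} (hA : ∀ n, A n = 1 ∨ A n = 2) {W : List ℕ} {m : ℕ} {i : ℤ}
    (hW : occursAtZ W A (i - m)) (hm : m < W.length)
    {N D : ℕ} (hD : 0 < D) (h : lamGt W m N D = true) :
    (N : ℝ) / D < lam A i := by
  obtain ⟨⟨r2, -, l2, -⟩, h2, -⟩ := lam_bounds hA hW hm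
  simp only [lamGt, decide_eq_true_eq] at h
  set r := (cfBounds (W.drop (m + 1))).1
  set l := (cfBounds (W.take m).reverse).1
  have h' : (N : ℝ) * (r.2 * l.2) < D * (W.getD m 0 * (r.2 * l.2) + r.1 * l.2 + l.1 * r.2) := by
    exact_mod_cast h
  have r2' : (0 : ℝ) < r.2 := by exact_mod_cast r2
  have l2' : (0 : ℝ) < l.2 := by exact_mod_cast l2
  have hD' : (0 : ℝ) < D := by exact_mod_cast hD
  refine lt_of_lt_of_le ?_ h2
  rw [div_lt_iff₀ hD', ← mul_lt_mul_iff_left₀ (mul_pos r2' l2')]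
  refine h'.trans_eq ?_
  field_simp

theorem occursAtZ_append {u v : List ℕ} {A : ℤ → ℕ} {j : ℤ} :
    occursAtZ (u ++ v) A j ↔ occursAtZ u A j ∧ occursAtZ v A (j + u.length) := by
  constructor
  · refine fun h => ⟨fun k hk => ?_, fun k hk => ?_⟩
    · rw [h k (by rw [List.length_append]; omega), List.getD_append _ _ _ _ hk]
    · rw [h.eq (u.length + k) (by rw [List.length_append]; omega) (by push_cast; ring),
        List.getD_append_right _ _ _ _ (by omega), Nat.add_sub_cancel_left]
  · rintro ⟨hu, hv⟩ k hk
    rw [List.length_append] at hk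
    rcases lt_or_ge k u.length with h | h
    · rw [hu k h, List.getD_append _ _ _ _ h]
    · rw [hv.eq (k - u.length) (by omega) (by omega), List.getD_append_right _ _ _ _ h]

theorem occursAtZ_singleton {a : ℕ} {A : ℤ → ℕ} {j : ℤ} : occursAtZ [a] A j ↔ A j = a := by
  simp [occursAtZ]

theorem occursAtZ_drop {W : List ℕ} {A : ℤ → ℕ} {j : ℤ} (h : occursAtZ W A j) {k : ℕ}
    (hk : k ≤ W.length) : occursAtZ (W.drop k) A (j + k) := by
  rw [← List.take_append_drop k W, occursAtZ_append] at h
  simpa [List.length_take, hk] using h.2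

/-- The rational number `3.11812017815`, as a pair (numerator, denominator). -/
abbrev loNum : ℕ := 311812017815
abbrev loDen : ℕ := 100000000000
/-- The rational number `3.1181201782`, as a pair (numerator, denominator). -/
abbrev hiNum : ℕ := 31181201782
abbrev hiDen : ℕ := 10000000000

/-- Words, with a marked position at which `λ` exceeds `3.1181201782`, up to transposition. -/
def heavyWords : List (List ℕ × ℕ) :=
  [([1,2,1], 1),
   ([1,2,2,2,1,2], 3),
   ([2,2,2,1,2,2,2], 4),
   ([1,1,2,2,1,2,2,2,2,2], 5),
   ([1,2,2,2,1,1,2,2,1,2,2,2,2,1,1,2], 9),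
   ([2,2,2,1,1,2,2,1,2,2,2,2,1,1,2,2,2], 8),
   ([2,2,1,1,2,2,2,2,1,2,2,1,1,2,2,2,2,2], 7),
   ([1,1,2,2,1,1,2,2,2,2,1,2,2,1,1,2,2,2], 9),
   ([1,1,2,2,2,2,1,1,2,2,1,2,2,2,2,1,1,2,2,1,2,2], 11),
   ([1,2,2,1,2,2,1,1,2,2,2,2,1,2,2,1,1,2,2,2,2,1,2,2], 11),
   ([2,1,2,2,1,2,2,2,2,1,1,2,2,1,2,2,2,2,1,1,2,2,1,2,2,2,2], 14),
   ([1,2,2,1,2,2,2,2,1,1,2,2,1,2,2,2,2,1,1,2,2,1,2,2,2,2,1,2], 13),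
   ([1,1,1,2,2,1,2,2,2,2,1,1,2,2,1,2,2,2,2,1,1,2,2,1,2,2,2,2,1], 15),
   ([1,1,1,2,2,2,2,1,2,2,1,1,2,2,2,2,1,2,2,1,1,2,2,2,2,1,2,2,1,1,2,2], 15)]

/-- The words of `heavyWords` and their transposes. -/
def allHeavyWords : List (List ℕ × ℕ) :=
  heavyWords ++ heavyWords.map fun p => (p.1.reverse, p.1.length - 1 - p.2)

theorem allHeavyWords_spec : ∀ p ∈ allHeavyWords, p.2 < p.1.length ∧
    lamGt p.1 p.2 hiNum hiDen = true := by
  decide +kernel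

/-- Search for words of `goals` around position `m` of `W` over all extensions of `W` by digits
in `{1, 2}` without heavy words (and, if `c` holds, with `λ` at the position `m` not forced below
`3.11812017815`). The parameters `p`, `q` determine on which side words get extended. -/
def forces (goals : List (List ℕ × ℕ)) (c : Bool) (p q : ℕ) : ℕ → List ℕ → ℕ → Bool
  | 0, _, _ => false
  | f + 1, W, m =>
    (c && lamLt W m loNum loDen) ||
    allHeavyWords.any (fun w => w.1.isPrefixOf W || w.1.isSuffixOf W) ||
    goals.any (fun g => decide (g.2 ≤ m) && g.1.isPrefixOf (W.drop (m - g.2))) ||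
    bif Nat.ble (W.length + p) (2 * m + 1 + q) then
      forces goals c p q f (W ++ [1]) m && forces goals c p q f (W ++ [2]) m
    else forces goals c p q f (1 :: W) (m + 1) && forces goals c p q f (2 :: W) (m + 1)

theorem exists_goal_of_forces {A : ℤ → ℕ} (hA : ∀ n, A n = 1 ∨ A n = 2) {i : ℤ}
    (hT : ∀ j, i - 80 ≤ j → j ≤ i + 80 → lam A j < (hiNum : ℝ) / hiDen)
    {goals : List (List ℕ × ℕ)} {c : Bool} (hc : c = true → (loNum : ℝ) / loDen < lam A i)
    {p q : ℕ} (f : ℕ) : ∀ {W : List ℕ} {m : ℕ}, m < W.length → m + f ≤ 80 → W.length + f ≤ 80 →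
      occursAtZ W A (i - m) → forces goals c p q f W m = true →
      ∃ g ∈ goals, occursAtZ g.1 A (i - g.2) := by
  induction f with
  | zero => intro W m _ _ _ _ h; simp [forces] at h
  | succ f ih =>
    intro W m hm h1 h2 hW h
    have hheavy : ∀ w ∈ allHeavyWords, ∀ j, i - 80 ≤ j → j + w.1.length ≤ i + 80 →
        ¬ occursAtZ w.1 A j := by
      intro w hw j hj1 hj2 ho
      obtain ⟨h3, h4⟩ := allHeavyWords_spec w hw
      have := lt_lam_of_lamGt hA (i := j + w.2) (by simpa using ho) h3 (by norm_num) h4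
      exact absurd (hT (j + w.2) (by omega) (by omega)) (by linarith)
    rw [forces, Bool.or_eq_true, Bool.or_eq_true, Bool.or_eq_true] at h
    rcases h with ((h | h) | h) | h
    · rw [Bool.and_eq_true] at h
      exact absurd (hc h.1) (lt_asymm (lam_lt_of_lamLt hA hW hm (by norm_num) h.2))
    · obtain ⟨w, hw, h⟩ := List.any_eq_true.1 h
      simp at h
      rcases h with ⟨t, rfl⟩ | ⟨t, rfl⟩
      · rw [List.length_append] at h2
        exact absurd (occursAtZ_append.1 hW).1 (hheavy w hw _ (by omega) (by omega))
      · rw [List.length_append] at h2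
        exact absurd (occursAtZ_append.1 hW).2 (hheavy w hw _ (by omega) (by omega))
    · obtain ⟨g, hg, h⟩ := List.any_eq_true.1 h
      simp at h
      obtain ⟨h3, t, ht⟩ := h
      have h4 := occursAtZ_drop hW (k := m - g.2) (by omega)
      rw [← ht, occursAtZ_append] at h4
      refine ⟨g, hg, ?_⟩
      convert h4.1 using 1
      omega
    · cases hb : Nat.ble (W.length + p) (2 * m + 1 + q) <;> rw [hb] at h
      · rw [cond_false, Bool.and_eq_true] at h
        have key : ∀ a, A (i - ((m + 1 : ℕ) : ℤ)) = a → occursAtZ (a :: W) A (i - (m + 1 : ℕ)) := by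
          intro a ha
          rw [← List.singleton_append, occursAtZ_append, occursAtZ_singleton]
          refine ⟨ha, ?_⟩
          convert hW using 1
          rw [List.length_singleton]
          push_cast
          ring
        rcases hA (i - (m + 1 : ℕ)) with ha | ha
        · exact ih (by simp; omega) (by omega) (by simp; omega) (key _ ha) h.1
        · exact ih (by simp; omega) (by omega) (by simp; omega) (key _ ha) h.2
      · rw [cond_true, Bool.and_eq_true] at h
        have key : ∀ a, A (i - m + W.length) = a → occursAtZ (W ++ [a]) A (i - m) := by
          intro a ha
          rw [occursAtZ_append, occursAtZ_singleton]
          exact ⟨hW, ha⟩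
        rcases hA (i - m + W.length) with ha | ha
        · exact ih (by simp; omega) (by omega) (by simp; omega) (key _ ha) h.1
        · exact ih (by simp; omega) (by omega) (by simp; omega) (key _ ha) h.2

/-- A window of 31 digits in the periodic sequence with period `2_4 1_2 2_2 1`. -/
def perWord : List ℕ :=
  [2,1,1,2,2,1,2,2,2,2,1,1,2,2,1,2,2,2,2,1,1,2,2,1,2,2,2,2,1,1,2]

theorem forces_perWord : forces [(perWord, 15), (perWord.reverse, 15)] true 0 0 60 [2] 0 = true := by
  decide +kernel

theorem forces_perWord_shift : forces [(perWord, 6)] false 0 1000 40 perWord 15 = true := by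
  decide +kernel

theorem forces_perWord_reverse_shift :
    forces [(perWord.reverse, 24)] false 1000 0 40 perWord.reverse 15 = true := by
  decide +kernel

theorem lam_comp_neg {A : ℤ → ℕ} (hA : ∀ n, 0 < A n) (i : ℤ) :
    lam (fun n => A (-n)) (-i) = lam A i := by
  rw [lam_eq (fun n => hA _), lam_eq hA, neg_neg, add_right_comm]
  congr 3
  · funext k; congr 1; ring
  · funext k; congr 1; ring

/-- The periodic bi-infinite sequence with period `2_4 1_2 2_2 1`. -/
abbrev per9 : ℤ → ℕ := perZ [2,2,2,2,1,1,2,2,1]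

theorem per9_eq (n : ℤ) : per9 n = ([2,2,2,2,1,1,2,2,1] : List ℕ).getD (n % 9).toNat 1 := rfl

/-- A window of 52 digits in `per9`. -/
def longPerWord : List ℕ :=
  [2,2,1,1,2,2,1,2,2,2,2,1,1,2,2,1,2,2,2,2,1,1,2,2,1,2,2,2,2,1,1,2,2,1,2,2,2,2,1,1,2,2,1,2,2,
   2,2,1,1,2,2,1]

theorem longPerWord_getD : ∀ j < 52,
    longPerWord.getD j 0 = ([2,2,2,2,1,1,2,2,1] : List ℕ).getD ((j + 2) % 9) 1 := by
  decide

theorem lamLt_longPerWord : ∀ r < 9, lamLt longPerWord (25 + r) loNum loDen = true := by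
  decide +kernel

theorem lam_lt_of_eq_per9 {A : ℤ → ℕ} (hA : ∀ n, A n = 1 ∨ A n = 2) {i i₀ : ℤ}
    (h : ∀ n, i - 34 ≤ n → n ≤ i + 34 → A n = per9 (n - i₀)) :
    lam A i < (loNum : ℝ) / loDen := by
  obtain ⟨r, hr⟩ : ∃ r : ℕ, (i - i₀) % 9 = r := ⟨((i - i₀) % 9).toNat, by omega⟩
  have hr9 : r < 9 := by omega
  refine lam_lt_of_lamLt hA (W := longPerWord) (m := 25 + r) ?_ (by simp [longPerWord]; omega)
    (by norm_num) (lamLt_longPerWord r hr9)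
  intro j hj
  have hj' : j < 52 := hj
  rw [longPerWord_getD j hj', h _ (by omega) (by omega), per9_eq]
  congr 1
  omega

theorem lam_lt_of_eq_per9_neg {A : ℤ → ℕ} (hA : ∀ n, A n = 1 ∨ A n = 2) {i i₀ : ℤ}
    (h : ∀ n, i - 34 ≤ n → n ≤ i + 34 → A n = per9 (i₀ - n)) :
    lam A i < (loNum : ℝ) / loDen := by
  rw [← lam_comp_neg fun n => by rcases hA n with e | e <;> omega]
  refine lam_lt_of_eq_per9 (fun n => hA _) (i₀ := -i₀) fun n h1 h2 => ?_
  rw [h _ (by omega) (by omega)]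
  congr 1
  ring

theorem lam_lt_of_eq_one {A : ℤ → ℕ} (hA : ∀ n, A n = 1 ∨ A n = 2) {i : ℤ} (h : A i = 1) :
    lam A i < (loNum : ℝ) / loDen :=
  lam_lt_of_lamLt hA (W := [1]) (m := 0) (by simpa [occursAtZ_singleton] using h) (by simp)
    (by norm_num) (by decide)

theorem perWord_getD : ∀ s < 9,
    perWord.getD (15 + s) 0 = ([2,2,2,2,1,1,2,2,1] : List ℕ).getD s 1 := by
  decide

theorem perWord_reverse_getD : ∀ s < 9,
    perWord.reverse.getD (15 - s) 0 = ([2,2,2,2,1,1,2,2,1] : List ℕ).getD s 1 := by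
  decide

theorem eventually_lam_le_of_eventually_lt {A : ℤ → ℕ} (hA : ∀ n, A n = 1 ∨ A n = 2) {N : ℤ}
    (hT : ∀ j, N ≤ j → lam A j < (hiNum : ℝ) / hiDen) :
    ∃ M, ∀ i, M ≤ i → lam A i ≤ (loNum : ℝ) / loDen := by
  by_contra! H
  by_cases hO : ∃ i₀, N + 80 ≤ i₀ ∧ occursAtZ perWord A (i₀ - 15)
  · obtain ⟨i₀, hi₀, hO⟩ := hO
    have hper : ∀ k : ℕ, occursAtZ perWord A (i₀ + 9 * k - 15) := by
      intro k
      induction k with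
      | zero => simpa using hO
      | succ k ih =>
        obtain ⟨g, hg, h⟩ := exists_goal_of_forces hA (i := i₀ + 9 * k)
          (fun j hj _ => hT j (by omega)) (by simp) 40 (by simp [perWord]) (by norm_num)
          (by simp [perWord]) ih forces_perWord_shift
        rw [List.mem_singleton] at hg
        subst hg
        convert h using 1
        push_cast
        ring
    obtain ⟨i, hi, hlt⟩ := H (i₀ + 40)
    refine lt_asymm hlt (lam_lt_of_eq_per9 hA (i₀ := i₀) fun n h1 _ => ?_)
    obtain ⟨k, hk⟩ : ∃ k : ℕ, (n - i₀) / 9 = k := ⟨((n - i₀) / 9).toNat, by omega⟩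
    obtain ⟨s, hs⟩ : ∃ s : ℕ, (n - i₀) % 9 = s := ⟨((n - i₀) % 9).toNat, by omega⟩
    rw [(hper k).eq (15 + s) (by simp [perWord]; omega) (by push_cast; omega),
      perWord_getD s (by omega), per9_eq, hs, Int.toNat_natCast]
  · push Not at hO
    have hOT : ∀ i, N + 80 ≤ i → (loNum : ℝ) / loDen < lam A i →
        occursAtZ perWord.reverse A (i - 15) := by
      intro i hi hlt
      have h2 : A i = 2 :=
        (hA i).resolve_left fun h1 => lt_asymm hlt (lam_lt_of_eq_one hA h1)
      obtain ⟨g, hg, h⟩ := exists_goal_of_forces hA (i := i)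
        (fun j hj _ => hT j (by omega)) (fun _ => hlt) 60 (by simp) (by norm_num)
        (by simp) (by simpa [occursAtZ_singleton] using h2) forces_perWord
      simp only [List.mem_cons, List.not_mem_nil, or_false] at hg
      rcases hg with rfl | rfl
      · exact absurd h (hO i hi)
      · exact h
    obtain ⟨i, hi, hlt⟩ := H (N + 300)
    obtain ⟨i₁, hi₁, hlt₁⟩ := H (i + 100)
    have hper : ∀ k : ℕ, N + 80 ≤ i₁ - 9 * k → occursAtZ perWord.reverse A (i₁ - 9 * k - 15) := by
      intro k
      induction k with
      | zero => intro _; simpa using hOT i₁ (by omega) hlt₁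
      | succ k ih =>
        intro hk
        push_cast at hk
        obtain ⟨g, hg, h⟩ := exists_goal_of_forces hA (i := i₁ - 9 * k)
          (fun j hj _ => hT j (by omega)) (by simp) 40 (by simp [perWord]) (by norm_num)
          (by simp [perWord]) (ih (by omega)) forces_perWord_reverse_shift
        rw [List.mem_singleton] at hg
        subst hg
        convert h using 1
        push_cast
        ring
    refine lt_asymm hlt (lam_lt_of_eq_per9_neg hA (i₀ := i₁) fun n h1 _ => ?_)
    obtain ⟨k, hk⟩ : ∃ k : ℕ, (i₁ - n) / 9 = k := ⟨((i₁ - n) / 9).toNat, by omega⟩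
    obtain ⟨s, hs⟩ : ∃ s : ℕ, (i₁ - n) % 9 = s := ⟨((i₁ - n) % 9).toNat, by omega⟩
    rw [(hper k (by omega)).eq (15 - s) (by simp [perWord]; omega) (by omega),
      perWord_reverse_getD s (by omega), per9_eq, hs, Int.toNat_natCast]

theorem le_lam {A : ℤ → ℕ} (hA : ∀ n, 0 < A n) (i : ℤ) : (A i : ℝ) ≤ lam A i := by
  rw [lam_eq hA]
  linarith [cf0_nonneg (g := fun n => A (i + 1 + n)) fun n => hA _,
    cf0_nonneg (g := fun n => A (i - 1 - n)) fun n => hA _]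

theorem one_or_two_of_lam_lt {A : ℤ → ℕ} (hA : ∀ n, 0 < A n) {i : ℤ}
    (h1 : lam A i < 13 / 4) (h2 : lam A (i + 1) < 13 / 4) : A i = 1 ∨ A i = 2 := by
  have h3 : A i < 4 := by
    have := (le_lam hA i).trans_lt h1
    have : (A i : ℝ) < 4 := by linarith
    exact_mod_cast this
  have h4 : A (i + 1) < 4 := by
    have := (le_lam hA (i + 1)).trans_lt h2
    have : (A (i + 1) : ℝ) < 4 := by linarith
    exact_mod_cast this
  have h5 : A i ≠ 3 := by
    intro h5
    rw [lam_eq hA, h5, cf0_eq fun n => hA _] at h1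
    have h6 := cf0_nonneg (g := fun n => A (i - 1 - n)) fun n => hA _
    have h7 := cf0_le_one (g := fun n : ℕ => A (i + 1 + (n + 1 : ℕ))) fun n => hA _
    have h8 := cf0_nonneg (g := fun n : ℕ => A (i + 1 + (n + 1 : ℕ))) fun n => hA _
    have h9 : (A (i + 1) : ℝ) ≤ 3 := by exact_mod_cast Nat.lt_succ_iff.1 h4
    have h10 : (1 : ℝ) ≤ A (i + 1) := by exact_mod_cast hA _
    have h11 : (1 : ℝ) / 4 ≤ 1 / (A (i + 1 + (0 : ℕ)) +
        cf0 (fun n : ℕ => A (i + 1 + (n + 1 : ℕ)))) := by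
      rw [Nat.cast_zero, add_zero]
      exact one_div_le_one_div_of_le (by linarith) (by linarith)
    push_cast at h1 h11
    linarith
  have := hA i
  omega

theorem notMem_lagrangeSpectrum {x : ℝ} (h1 : (loNum : ℝ) / loDen < x)
    (h2 : x < (hiNum : ℝ) / hiDen) : x ∉ LagrangeSpectrum := by
  rintro ⟨B, hB, hbd, rfl⟩
  obtain ⟨u, hu1, hu2⟩ := exists_between h1
  obtain ⟨t, ht1, ht2⟩ := exists_between h2
  have hev := eventually_lt_of_limsup_lt (show limsup (lam B) atTop < t from ht1) hbd
  obtain ⟨N, hN⟩ := eventually_atTop.1 hev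
  have ht3 : t < 13 / 4 := ht2.trans (by norm_num)
  have hB12 : ∀ n, N ≤ n → B n = 1 ∨ B n = 2 := fun n hn =>
    one_or_two_of_lam_lt hB ((hN n hn).trans ht3) ((hN (n + 1) (by omega)).trans ht3)
  set A : ℤ → ℕ := fun n => if N ≤ n then B n else 1 with hAdef
  have hA12 : ∀ n, A n = 1 ∨ A n = 2 := by
    intro n
    by_cases hn : N ≤ n
    · simpa [hAdef, hn] using hB12 n hn
    · simp [hAdef, hn]
  have hA : ∀ n, 0 < A n := fun n => by rcases hA12 n with e | e <;> omega
  obtain ⟨k, hk⟩ := exists_pow_lt_of_lt_one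
    (lt_min (sub_pos.2 hu1) (sub_pos.2 ht2)) (show (1 / 4 : ℝ) < 1 by norm_num)
  obtain ⟨hk1, hk2⟩ := lt_min_iff.1 hk
  have hclose : ∀ i, N + 2 * k + 1 ≤ i → |lam A i - lam B i| ≤ (1 / 4) ^ k := by
    intro i hi
    rw [lam_eq hA, lam_eq hB]
    have e1 : A i = B i := if_pos (by omega)
    have e2 : (fun n : ℕ => A (i + 1 + n)) = fun n : ℕ => B (i + 1 + n) :=
      funext fun n => if_pos (by omega)
    rw [e1, e2]
    have e3 := abs_cf0_sub_le k (g := fun n => A (i - 1 - n)) (h := fun n => B (i - 1 - n))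
      (fun n => hA _) (fun n => hB _) (fun n hn => if_pos (by omega))
    convert e3 using 2
    ring
  obtain ⟨M, hM⟩ := eventually_lam_le_of_eventually_lt hA12 (N := N + 2 * k + 1) fun j hj => by
    have := (abs_le.1 (hclose j hj)).2
    have := hN j (by omega)
    linarith
  have hle : limsup (lam B) atTop ≤ u := by
    refine limsup_le_of_le (isCoboundedUnder_le_of_le atTop (x := 0) fun i =>
      (Nat.cast_nonneg _).trans (le_lam hB i)) ?_
    filter_upwards [eventually_ge_atTop M, eventually_ge_atTop (N + 2 * k + 1)] with i hi hi'
    have := (abs_le.1 (hclose i hi')).1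
    have := hM i hi
    linarith
  exact absurd hle (not_le.2 hu2)

/-- The bi-infinite sequence with right half `a` and left half `b`, read from right to left. -/
def glue (a b : ℕ → ℕ) : ℤ → ℕ := fun n => if 0 ≤ n then a n.toNat else b (-1 - n).toNat

theorem lam_glue_zero (a b : ℕ → ℕ) : lam (glue a b) 0 = cfVal a + cf0 b := by
  rw [lam]
  congr 2
  · funext n
    simp [glue]
  · funext n
    rw [glue, if_neg (by omega)]
    congr 1
    omega

theorem glue_one_two {a b : ℕ → ℕ} (ha : ∀ n, a n = 1 ∨ a n = 2) (hb : ∀ n, b n = 1 ∨ b n = 2)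
    (n : ℤ) : glue a b n = 1 ∨ glue a b n = 2 := by
  rw [glue]
  split_ifs
  · exact ha _
  · exact hb _

theorem getD_one_two {w : List ℕ} (hw : ∀ d ∈ w, d = 1 ∨ d = 2) (n : ℕ) :
    w.getD n 1 = 1 ∨ w.getD n 1 = 2 := by
  rcases lt_or_ge n w.length with h | h
  · rw [List.getD_eq_getElem _ _ h]
    exact hw _ (List.getElem_mem h)
  · rw [List.getD_eq_default _ _ h]
    exact Or.inl rfl

theorem perSeq_one_two {w : List ℕ} (hw : ∀ d ∈ w, d = 1 ∨ d = 2) (n : ℕ) :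
    perSeq w n = 1 ∨ perSeq w n = 2 := getD_one_two hw _

theorem catSeq_one_two {w : List ℕ} (hw : ∀ d ∈ w, d = 1 ∨ d = 2) {g : ℕ → ℕ}
    (hg : ∀ n, g n = 1 ∨ g n = 2) (n : ℕ) : catSeq w g n = 1 ∨ catSeq w g n = 2 := by
  rw [catSeq]
  split_ifs
  · exact getD_one_two hw _
  · exact hg _

/-- The word of `n` consecutive digits of `A` starting at position `j`. -/
def window (A : ℤ → ℕ) (j : ℤ) (n : ℕ) : List ℕ := (List.range n).map fun k : ℕ => A (j + k)

theorem length_window (A : ℤ → ℕ) (j : ℤ) (n : ℕ) : (window A j n).length = n := by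
  simp [window]

theorem occursAtZ_window {A B : ℤ → ℕ} {j : ℤ} {n : ℕ} (h : ∀ k < n, B (j + k) = A (j + k)) :
    occursAtZ (window A j n) B j := by
  intro k hk
  rw [length_window] at hk
  rw [h k hk, List.getD_eq_getElem _ _ (by rwa [length_window])]
  simp [window]

theorem cInf_lt : cInf < (loNum : ℝ) / loDen := by
  rw [cInf, ← lam_glue_zero]
  refine lam_lt_of_lamLt (glue_one_two (perSeq_one_two (by decide)) (perSeq_one_two (by decide)))
    (m := 30) (occursAtZ_window (n := 60) fun _ _ => rfl) (by simp [length_window])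
    (by norm_num) (by decide +kernel)

theorem lt_CInf : (hiNum : ℝ) / hiDen < CInf := by
  rw [CInf, ← lam_glue_zero]
  refine lt_lam_of_lamGt (glue_one_two
      (catSeq_one_two (by decide) (perSeq_one_two (by decide)))
      (catSeq_one_two (by decide) (perSeq_one_two (by decide))))
    (m := 30) (occursAtZ_window (n := 60) fun _ _ => rfl) (by simp [length_window])
    (by norm_num) (by decide +kernel)

/-- The digit at a given place of a concatenation of the blocks `1` and `2 2 1`: label `0` stands
for the block `1`, and labels `1, 2, 3` stand for the successive digits of the block `2 2 1`. -/
def labelDigit (k : ℕ) : ℕ := if k = 1 ∨ k = 2 then 2 else 1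

theorem labelDigit_one_two (k : ℕ) : labelDigit k = 1 ∨ labelDigit k = 2 := by
  rw [labelDigit]
  split_ifs <;> simp

/-- `e` is the sequence of labels of a concatenation of the blocks `1` and `2 2 1`. -/
def IsLabelling (e : ℕ → ℕ) : Prop := ∀ n,
  (e n = 0 ∧ (e (n + 1) = 0 ∨ e (n + 1) = 1)) ∨ (e n = 1 ∧ e (n + 1) = 2) ∨
  (e n = 2 ∧ e (n + 1) = 3) ∨ (e n = 3 ∧ (e (n + 1) = 0 ∨ e (n + 1) = 1))

theorem occursAtZ_nil {A : ℤ → ℕ} {j : ℤ} : occursAtZ [] A j ↔ True := by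
  simp [occursAtZ]

theorem occursAtZ_cons {a : ℕ} {W : List ℕ} {A : ℤ → ℕ} {j : ℤ} :
    occursAtZ (a :: W) A j ↔ A j = a ∧ occursAtZ W A (j + 1) := by
  rw [← List.singleton_append, occursAtZ_append, occursAtZ_singleton]
  simp

theorem lam_lt_of_isLabelling {A : ℤ → ℕ} (hA : ∀ n, A n = 1 ∨ A n = 2) {e : ℕ → ℕ}
    (he : IsLabelling e) (h1 : e 1 = 0) {c : ℤ}
    (h : ∀ n : ℕ, A (c - n) = labelDigit (e n)) (n : ℕ) :
    lam A (c - (n + 2 : ℕ)) < (loNum : ℝ) / loDen := by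
  have d1 : ∀ z (k : ℕ), z = c - k → (e k = 0 ∨ e k = 3) → A z = 1 := by
    rintro z k rfl hk
    rw [h, labelDigit, if_neg (by omega)]
  have d2 : ∀ z (k : ℕ), z = c - k → (e k = 1 ∨ e k = 2) → A z = 2 := by
    rintro z k rfl hk
    rw [h, labelDigit, if_pos hk]
  have a0 := he n
  have a1 := he (n + 1)
  have a2 := he (n + 2)
  have a3 := he (n + 3)
  have a4 := he (n + 4)
  simp only [add_assoc, Nat.reduceAdd] at a1 a2 a3 a4
  rcases show (e (n + 2) = 0 ∨ e (n + 2) = 3) ∨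
      (e (n + 2) = 1 ∧ e (n + 1) = 0) ∨ (e (n + 2) = 1 ∧ e (n + 1) = 3) ∨
      (e (n + 2) = 2 ∧ e (n + 4) = 0) ∨ (e (n + 2) = 2 ∧ e (n + 4) = 1) by omega with
    hc | ⟨hc, hc'⟩ | ⟨hc, hc'⟩ | ⟨hc, hc'⟩ | ⟨hc, hc'⟩
  · exact lam_lt_of_eq_one hA (d1 _ _ rfl hc)
  · refine lam_lt_of_lamLt hA (W := [1,2,2,1,1]) (m := 2) ?_ (by simp) (by norm_num)
      (by decide +kernel)
    simp only [occursAtZ_cons, occursAtZ_nil, and_true]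
    exact ⟨d1 _ (n + 4) (by push_cast; ring) (by omega), d2 _ (n + 3) (by push_cast; ring) (by omega),
      d2 _ (n + 2) (by push_cast; ring) (by omega), d1 _ (n + 1) (by push_cast; ring) (by omega),
      d1 _ n (by push_cast; ring) (by omega)⟩
  · obtain ⟨k, rfl⟩ : ∃ k, n = k + 1 := ⟨n - 1, by
      rcases Nat.eq_zero_or_pos n with rfl | hn
      · simp only [zero_add] at hc'; omega
      · omega⟩
    have b0 := he k
    refine lam_lt_of_lamLt hA (W := [1,2,2,1,2,2]) (m := 2) ?_ (by simp) (by norm_num)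
      (by decide +kernel)
    simp only [occursAtZ_cons, occursAtZ_nil, and_true]
    exact ⟨d1 _ (k + 1 + 4) (by push_cast; ring) (by omega),
      d2 _ (k + 1 + 3) (by push_cast; ring) (by omega),
      d2 _ (k + 1 + 2) (by push_cast; ring) (by omega),
      d1 _ (k + 1 + 1) (by push_cast; ring) (by omega),
      d2 _ (k + 1) (by push_cast; ring) (by omega), d2 _ k (by push_cast; ring) (by omega)⟩
  · refine lam_lt_of_lamLt hA (W := [1,1,2,2,1]) (m := 2) ?_ (by simp) (by norm_num)
      (by decide +kernel)
    simp only [occursAtZ_cons, occursAtZ_nil, and_true]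
    exact ⟨d1 _ (n + 4) (by push_cast; ring) (by omega), d1 _ (n + 3) (by push_cast; ring) (by omega),
      d2 _ (n + 2) (by push_cast; ring) (by omega), d2 _ (n + 1) (by push_cast; ring) (by omega),
      d1 _ n (by push_cast; ring) (by omega)⟩
  · refine lam_lt_of_lamLt hA (W := [2,2,1,2,2,1]) (m := 3) ?_ (by simp) (by norm_num)
      (by decide +kernel)
    simp only [occursAtZ_cons, occursAtZ_nil, and_true]
    exact ⟨d2 _ (n + 5) (by push_cast; ring) (by omega),
      d2 _ (n + 4) (by push_cast; ring) (by omega), d1 _ (n + 3) (by push_cast; ring) (by omega),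
      d2 _ (n + 2) (by push_cast; ring) (by omega), d2 _ (n + 1) (by push_cast; ring) (by omega),
      d1 _ n (by push_cast; ring) (by omega)⟩

/-- The word which precedes the block `2_4 1_2 2_2 1` in `markovSeq`, transposed. -/
def stemWord : List ℕ := [1,2,2,1,1,2,2,2,2,1,2,2,1,1,2,2,1,1]

/-- A sequence which agrees with `per9` to the right of position `-17`, and is given by the
concatenation of the blocks `1` and `2 2 1` labelled by `e` to the left of it. -/
def markovSeq (e : ℕ → ℕ) : ℤ → ℕ :=
  glue (perSeq [2,2,2,2,1,1,2,2,1]) (catSeq stemWord fun n => labelDigit (e n))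

theorem markovSeq_one_two (e : ℕ → ℕ) (n : ℤ) : markovSeq e n = 1 ∨ markovSeq e n = 2 :=
  glue_one_two (perSeq_one_two (by decide))
    (catSeq_one_two (by decide) fun _ => labelDigit_one_two _) n

theorem markovSeq_eq_of_le (e f : ℕ → ℕ) {n : ℤ} (hn : -18 ≤ n) :
    markovSeq e n = markovSeq f n := by
  rw [markovSeq, markovSeq, glue, glue]
  split_ifs with h
  · rfl
  · have : (-1 - n).toNat < stemWord.length := by simp [stemWord]; omega
    rw [catSeq, catSeq, if_pos this, if_pos this]

theorem stemWord_getD : ∀ k < 16,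
    stemWord.getD k 1 = ([2,2,2,2,1,1,2,2,1] : List ℕ).getD (8 - k % 9) 1 := by
  decide

theorem markovSeq_eq_per9 (e : ℕ → ℕ) {n : ℤ} (hn : -16 ≤ n) : markovSeq e n = per9 n := by
  rw [markovSeq, glue, per9_eq]
  split_ifs with h
  · rw [perSeq]
    congr 1
    simp only [List.length_cons, List.length_nil]
    omega
  · rw [catSeq, if_pos (by simp [stemWord]; omega), stemWord_getD _ (by omega)]
    congr 1
    omega

theorem occursAtZ_markovSeq (e : ℕ → ℕ) :
    occursAtZ (window (markovSeq fun _ => 0) (-18) 54) (markovSeq e) (-18) :=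
  occursAtZ_window fun k _ => markovSeq_eq_of_le _ _ (by omega)

theorem lamLt_markovSeq : ∀ m < 36, m ≠ 18 →
    lamLt (window (markovSeq fun _ => 0) (-18) 54) m loNum loDen = true := by
  decide +kernel

theorem lam_markovSeq_zero_mem (e : ℕ → ℕ) :
    lam (markovSeq e) 0 ∈ Ioo ((loNum : ℝ) / loDen) ((hiNum : ℝ) / hiDen) :=
  ⟨lt_lam_of_lamGt (markovSeq_one_two e) (m := 18) (occursAtZ_markovSeq e)
      (by simp [length_window]) (by norm_num) (by decide +kernel),
    lam_lt_of_lamLt (markovSeq_one_two e) (m := 18) (occursAtZ_markovSeq e)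
      (by simp [length_window]) (by norm_num) (by decide +kernel)⟩

theorem lam_markovSeq_lt {e : ℕ → ℕ} (he : IsLabelling e) (h0 : e 0 = 0 ∨ e 0 = 1) {i : ℤ}
    (hi : i ≠ 0) : lam (markovSeq e) i < (loNum : ℝ) / loDen := by
  have hA := markovSeq_one_two e
  rcases lt_or_ge 17 i with h1 | h1
  · exact lam_lt_of_eq_per9 hA (i₀ := 0) fun n hn _ => by
      rw [markovSeq_eq_per9 e (by omega), sub_zero]
  rcases lt_or_ge i (-18) with h2 | h2
  · have hE : IsLabelling fun n => if n < 2 then 0 else e (n - 2) := by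
      intro n
      match n with
      | 0 => simp
      | 1 => simpa using h0
      | n + 2 => simpa using he n
    have := lam_lt_of_isLabelling hA hE (by simp) (c := -17) (fun n => by
      rw [markovSeq, glue, if_neg (by omega), catSeq]
      have hl : stemWord.length = 18 := rfl
      match n with
      | 0 => rfl
      | 1 => rfl
      | n + 2 =>
        rw [if_neg (by omega), if_neg (by omega)]
        congr 2
        omega) (-19 - i).toNat
    convert this using 2
    omega
  · exact lam_lt_of_lamLt hA (m := (i + 18).toNat) (by
      convert occursAtZ_markovSeq e using 1
      omega) (by rw [length_window]; omega) (by norm_num) (lamLt_markovSeq _ (by omega) (by omega))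

theorem lam_markovSeq_zero_mem_spectrum {e : ℕ → ℕ} (he : IsLabelling e)
    (h0 : e 0 = 0 ∨ e 0 = 1) :
    lam (markovSeq e) 0 ∈ (MarkovSpectrum \ LagrangeSpectrum) ∩ Ioo cInf CInf := by
  obtain ⟨h1, h2⟩ := lam_markovSeq_zero_mem e
  have hmax : IsGreatest (range (lam (markovSeq e))) (lam (markovSeq e) 0) := by
    refine ⟨mem_range_self 0, ?_⟩
    rintro _ ⟨i, rfl⟩
    by_cases hi : i = 0
    · rw [hi]
    · exact ((lam_markovSeq_lt he h0 hi).trans h1).le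
  refine ⟨⟨⟨markovSeq e, fun n => ?_, hmax.bddAbove, hmax.csSup_eq.symm⟩,
    notMem_lagrangeSpectrum h1 h2⟩, cInf_lt.trans h1, h2.trans lt_CInf⟩
  rcases markovSeq_one_two e n with h | h <;> omega

/-- One step of the coding of points of `[0, 1)` by concatenations of the blocks `1` and `2 2 1`,
where the two blocks are given the weights `73 / 100` and `27 / 100`. The first component of a
state is `0` when a new block begins, and otherwise counts the digits of the current block. -/
noncomputable def codeStep (s : ℕ × ℝ) : ℕ × ℝ :=
  if s.1 = 0 then
    if s.2 < 73 / 100 then (0, s.2 / (73 / 100)) else (1, (s.2 - 73 / 100) / (27 / 100))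
  else if s.1 = 1 then (2, s.2) else (0, s.2)

/-- The label of the current digit in a given state of the coding. -/
noncomputable def codeLabel (s : ℕ × ℝ) : ℕ :=
  if s.1 = 0 then if s.2 < 73 / 100 then 0 else 1 else if s.1 = 1 then 2 else 3

/-- The sequence of labels produced by the coding from a given state. -/
noncomputable def codeSeq (s : ℕ × ℝ) (n : ℕ) : ℕ := codeLabel (codeStep^[n] s)

theorem isLabelling_codeSeq (s : ℕ × ℝ) : IsLabelling (codeSeq s) := by
  intro n
  rw [codeSeq, codeSeq, Function.iterate_succ_apply']
  generalize codeStep^[n] s = t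
  unfold codeLabel codeStep
  split_ifs <;> simp_all

theorem codeSeq_zero (y : ℝ) : codeSeq (0, y) 0 = 0 ∨ codeSeq (0, y) 0 = 1 := by
  by_cases h : y < 73 / 100 <;> simp [codeSeq, codeLabel, h]

/-- The continued fraction `[0; w₀, w₁, …]` whose blocks `w₀, w₁, …` are given by the coding. -/
noncomputable def codeVal (s : ℕ × ℝ) : ℝ := cf0 fun n => labelDigit (codeSeq s n)

theorem codeVal_mem (s : ℕ × ℝ) : 4 / 11 ≤ codeVal s ∧ codeVal s ≤ 11 / 15 :=
  cf0_mem_of_one_two fun _ => labelDigit_one_two _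

theorem codeVal_eq (s : ℕ × ℝ) :
    codeVal s = 1 / (labelDigit (codeLabel s) + codeVal (codeStep s)) := by
  rw [codeVal, cf0_eq fun n => by rcases labelDigit_one_two (codeSeq s n) with h | h <;> omega]
  rfl

theorem codeVal_of_lt {y : ℝ} (hy : y < 73 / 100) :
    codeVal (0, y) = 1 / (1 + codeVal (0, y / (73 / 100))) := by
  rw [codeVal_eq]
  simp [codeLabel, codeStep, hy, labelDigit]

theorem codeVal_of_ge {y : ℝ} (hy : 73 / 100 ≤ y) :
    codeVal (0, y) = 1 / (2 + 1 / (2 + 1 / (1 + codeVal (0, (y - 73 / 100) / (27 / 100))))) := by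
  rw [codeVal_eq, codeVal_eq (codeStep _), codeVal_eq (codeStep (codeStep _))]
  simp [codeLabel, codeStep, hy.not_gt, labelDigit]

theorem mul_abs_sub_le_of_one {x y : ℝ} (hx : 0 ≤ x) (hy : 0 ≤ y) (hx' : x ≤ 11 / 15)
    (hy' : y ≤ 11 / 15) : 16 / 49 * |x - y| ≤ |1 / (1 + x) - 1 / (1 + y)| := by
  have e : 1 / (1 + x) - 1 / (1 + y) = -(x - y) / ((1 + x) * (1 + y)) := by
    field_simp
    ring
  rw [e, abs_div, abs_neg, abs_of_pos (show 0 < (1 + x) * (1 + y) by positivity),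
    le_div_iff₀ (by positivity)]
  have : (1 + x) * (1 + y) ≤ 26 / 15 * (26 / 15) :=
    mul_le_mul (by linarith) (by linarith) (by linarith) (by norm_num)
  nlinarith [abs_nonneg (x - y)]

theorem mul_abs_sub_le_of_two {x y : ℝ} (hx : 0 ≤ x) (hy : 0 ≤ y) (hx' : x ≤ 11 / 15)
    (hy' : y ≤ 11 / 15) : 16 / 1849 * |x - y| ≤
      |1 / (2 + 1 / (2 + 1 / (1 + x))) - 1 / (2 + 1 / (2 + 1 / (1 + y)))| := by
  have e : ∀ z : ℝ, 0 ≤ z → 1 / (2 + 1 / (2 + 1 / (1 + z))) = (3 + 2 * z) / (7 + 5 * z) := by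
    intro z hz
    have : 2 + 1 / (1 + z) = (3 + 2 * z) / (1 + z) := by field_simp; ring
    rw [this, one_div_div]
    have : 2 + (1 + z) / (3 + 2 * z) = (7 + 5 * z) / (3 + 2 * z) := by field_simp; ring
    rw [this, one_div_div]
  have e' : (3 + 2 * x) / (7 + 5 * x) - (3 + 2 * y) / (7 + 5 * y) =
      -(x - y) / ((7 + 5 * x) * (7 + 5 * y)) := by
    field_simp
    ring
  rw [e x hx, e y hy, e', abs_div, abs_neg,
    abs_of_pos (show 0 < (7 + 5 * x) * (7 + 5 * y) by positivity), le_div_iff₀ (by positivity)]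
  have : (7 + 5 * x) * (7 + 5 * y) ≤ 32 / 3 * (32 / 3) :=
    mul_le_mul (by linarith) (by linarith) (by linarith) (by norm_num)
  nlinarith [abs_nonneg (x - y)]

theorem le_rpow_five_div_nineteen {a b : ℝ} (hb : 0 ≤ b) (h : a ^ 19 ≤ b ^ 5) :
    a ≤ b ^ (5 / 19 : ℝ) := by
  refine le_of_pow_le_pow_left₀ (n := 19) (by norm_num) (by positivity) ?_
  rw [← Real.rpow_mul_natCast hb]
  norm_num
  exact_mod_cast h

theorem mul_rpow_le_rpow {a c x y : ℝ} (hc : 0 ≤ c) (h : a ^ 19 ≤ c ^ 5)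
    (hx : 0 ≤ x) (hxy : c * x ≤ y) : a * x ^ (5 / 19 : ℝ) ≤ y ^ (5 / 19 : ℝ) := by
  calc a * x ^ (5 / 19 : ℝ) ≤ c ^ (5 / 19 : ℝ) * x ^ (5 / 19 : ℝ) :=
        mul_le_mul_of_nonneg_right (le_rpow_five_div_nineteen hc h) (by positivity)
    _ = (c * x) ^ (5 / 19 : ℝ) := (Real.mul_rpow hc hx).symm
    _ ≤ y ^ (5 / 19 : ℝ) := Real.rpow_le_rpow (by positivity) hxy (by norm_num)

theorem one_div_le_codeVal_sub {x y : ℝ} (hx : x < 73 / 100) (hy : 73 / 100 ≤ y) :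
    1 / 14 ≤ codeVal (0, x) - codeVal (0, y) := by
  rw [codeVal_of_lt hx, codeVal_of_ge hy]
  obtain ⟨h1, h2⟩ := codeVal_mem (0, x / (73 / 100))
  obtain ⟨h3, h4⟩ := codeVal_mem (0, (y - 73 / 100) / (27 / 100))
  set u := codeVal (0, x / (73 / 100))
  set v := codeVal (0, (y - 73 / 100) / (27 / 100))
  have h5 : 15 / 26 ≤ 1 / (1 + u) := by
    rw [le_div_iff₀ (by linarith)]
    linarith
  have h6 : 1 / (2 + 1 / (2 + 1 / (1 + v))) ≤ 1 / 2 :=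
    one_div_le_one_div_of_le (by norm_num) (le_add_of_nonneg_right (by positivity))
  linarith

theorem abs_sub_le_codeVal (n : ℕ) : ∀ x ∈ Ico (0 : ℝ) 1, ∀ y ∈ Ico (0 : ℝ) 1,
    |x - y| ≤ 14 * |codeVal (0, x) - codeVal (0, y)| ^ (5 / 19 : ℝ) + (73 / 100) ^ n := by
  have hmixed : ∀ {x y d : ℝ}, x ∈ Ico (0 : ℝ) 1 → y ∈ Ico (0 : ℝ) 1 → 1 / 14 ≤ d → d ≤ 1 →
      |x - y| ≤ 14 * d ^ (5 / 19 : ℝ) := by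
    intro x y d hx hy hd hd1
    have h1 : d ^ (1 : ℝ) ≤ d ^ (5 / 19 : ℝ) :=
      Real.rpow_le_rpow_of_exponent_ge (by linarith) hd1 (by norm_num)
    rw [Real.rpow_one] at h1
    have h2 : |x - y| ≤ 1 := abs_le.2 ⟨by linarith [hx.1, hy.2], by linarith [hx.2, hy.1]⟩
    linarith
  have hle : ∀ s t, |codeVal s - codeVal t| ≤ 1 := fun s t =>
    abs_le.2 ⟨by linarith [(codeVal_mem s).1, (codeVal_mem t).2],
      by linarith [(codeVal_mem s).2, (codeVal_mem t).1]⟩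
  induction n with
  | zero =>
    intro x hx y hy
    have h2 : |x - y| ≤ 1 := abs_le.2 ⟨by linarith [hx.1, hy.2], by linarith [hx.2, hy.1]⟩
    have h3 : 0 ≤ |codeVal (0, x) - codeVal (0, y)| ^ (5 / 19 : ℝ) := by positivity
    rw [pow_zero]
    linarith
  | succ n ih =>
    intro x hx y hy
    have hpow : (0 : ℝ) ≤ (73 / 100) ^ n := by positivity
    rcases lt_or_ge x (73 / 100) with h1 | h1 <;> rcases lt_or_ge y (73 / 100) with h2 | h2
    · have h3 := ih (x / (73 / 100)) ⟨by have := hx.1; positivity, by linarith⟩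
        (y / (73 / 100)) ⟨by have := hy.1; positivity, by linarith⟩
      rw [codeVal_of_lt h1, codeVal_of_lt h2, pow_succ]
      obtain ⟨b1, b2⟩ := codeVal_mem (0, x / (73 / 100))
      obtain ⟨b3, b4⟩ := codeVal_mem (0, y / (73 / 100))
      have h4 := mul_rpow_le_rpow (a := 73 / 100) (by norm_num) (by norm_num)
        (abs_nonneg _) (mul_abs_sub_le_of_one (by linarith) (by linarith) b2 b4)
      rw [← sub_div, abs_div, abs_of_pos (show (0 : ℝ) < 73 / 100 by norm_num),
        div_le_iff₀ (by norm_num)] at h3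
      linarith
    · refine (hmixed hx hy ?_ (hle _ _)).trans (le_add_of_nonneg_right (by positivity))
      exact (one_div_le_codeVal_sub h1 h2).trans (le_abs_self _)
    · refine (hmixed hx hy ?_ (hle _ _)).trans (le_add_of_nonneg_right (by positivity))
      rw [abs_sub_comm]
      exact (one_div_le_codeVal_sub h2 h1).trans (le_abs_self _)
    · have h3 := ih ((x - 73 / 100) / (27 / 100))
        ⟨div_nonneg (by linarith) (by norm_num), by linarith [hx.2]⟩
        ((y - 73 / 100) / (27 / 100))
        ⟨div_nonneg (by linarith) (by norm_num), by linarith [hy.2]⟩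
      rw [codeVal_of_ge h1, codeVal_of_ge h2, pow_succ]
      obtain ⟨b1, b2⟩ := codeVal_mem (0, (x - 73 / 100) / (27 / 100))
      obtain ⟨b3, b4⟩ := codeVal_mem (0, (y - 73 / 100) / (27 / 100))
      have h4 := mul_rpow_le_rpow (a := 27 / 100) (by norm_num) (by norm_num)
        (abs_nonneg _) (mul_abs_sub_le_of_two (by linarith) (by linarith) b2 b4)
      rw [← sub_div, abs_div, abs_of_pos (show (0 : ℝ) < 27 / 100 by norm_num),
        div_le_iff₀ (by norm_num), sub_sub_sub_cancel_right] at h3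
      linarith

theorem abs_sub_le_codeVal_rpow {x y : ℝ} (hx : x ∈ Ico (0 : ℝ) 1) (hy : y ∈ Ico (0 : ℝ) 1) :
    |x - y| ≤ 14 * |codeVal (0, x) - codeVal (0, y)| ^ (5 / 19 : ℝ) := by
  have h : Tendsto (fun n : ℕ => 14 * |codeVal (0, x) - codeVal (0, y)| ^ (5 / 19 : ℝ) +
      (73 / 100 : ℝ) ^ n) atTop (𝓝 (14 * |codeVal (0, x) - codeVal (0, y)| ^ (5 / 19 : ℝ) + 0)) :=
    tendsto_const_nhds.add (tendsto_pow_atTop_nhds_zero_of_lt_one (by norm_num) (by norm_num))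
  rw [add_zero] at h
  exact ge_of_tendsto' h fun n => abs_sub_le_codeVal n x hx y hy

theorem abs_cf0_catSeq_sub_ge {w : List ℕ} (hw : ∀ d ∈ w, d = 1 ∨ d = 2) {g h : ℕ → ℕ}
    (hg : ∀ n, g n = 1 ∨ g n = 2) (hh : ∀ n, h n = 1 ∨ h n = 2) :
    |cf0 g - cf0 h| ≤ 9 ^ w.length * |cf0 (catSeq w g) - cf0 (catSeq w h)| := by
  induction w with
  | nil =>
    have h0 : ∀ f, catSeq [] f = f := fun f => by funext n; simp [catSeq]
    simp [h0]
  | cons a w ih =>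
    have hw' : ∀ d ∈ w, d = 1 ∨ d = 2 := fun d hd => hw d (List.mem_cons_of_mem _ hd)
    have key : ∀ f : ℕ → ℕ, (∀ n, f n = 1 ∨ f n = 2) →
        cf0 (catSeq (a :: w) f) = 1 / (a + cf0 (catSeq w f)) := by
      intro f hf
      rw [cf0_eq fun n => by rcases catSeq_one_two hw hf n with e | e <;> omega]
      congr 3
      funext n
      simp [catSeq]
    refine (ih hw').trans ?_
    rw [key g hg, key h hh, List.length_cons, pow_succ, mul_assoc]
    refine mul_le_mul_of_nonneg_left ?_ (by positivity)
    obtain ⟨b1, b2⟩ := cf0_mem_of_one_two (catSeq_one_two hw' hg)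
    obtain ⟨b3, b4⟩ := cf0_mem_of_one_two (catSeq_one_two hw' hh)
    set u := cf0 (catSeq w g)
    set v := cf0 (catSeq w h)
    have ha : (1 : ℝ) ≤ a ∧ (a : ℝ) ≤ 2 := by
      rcases hw a (by simp) with e | e <;> rw [e] <;> norm_num
    have hu : 0 < a + u := by linarith
    have hv : 0 < a + v := by linarith
    have e : 1 / (a + u) - 1 / (a + v) = -(u - v) / ((a + u) * (a + v)) := by
      field_simp
      ring
    rw [e, abs_div, abs_neg, abs_of_pos (mul_pos hu hv), mul_div_assoc',
      le_div_iff₀ (mul_pos hu hv), mul_comm]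
    exact mul_le_mul_of_nonneg_right (by nlinarith) (abs_nonneg _)

/-- The Markov value of the sequence attached to a point of `[0, 1)`. -/
noncomputable def codeMarkov (y : ℝ) : ℝ := lam (markovSeq (codeSeq (0, y))) 0

theorem abs_sub_le_codeMarkov {x y : ℝ} (hx : x ∈ Ico (0 : ℝ) 1) (hy : y ∈ Ico (0 : ℝ) 1) :
    |x - y| ≤ 14 * (9 ^ 18) ^ (5 / 19 : ℝ) * |codeMarkov x - codeMarkov y| ^ (5 / 19 : ℝ) := by
  have h := abs_cf0_catSeq_sub_ge (w := stemWord) (by decide)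
    (fun n => labelDigit_one_two (codeSeq (0, x) n))
    (fun n => labelDigit_one_two (codeSeq (0, y) n))
  rw [codeMarkov, codeMarkov, markovSeq, markovSeq, lam_glue_zero, lam_glue_zero,
    add_sub_add_left_eq_sub, mul_assoc, ← Real.mul_rpow (by positivity) (abs_nonneg _)]
  refine (abs_sub_le_codeVal_rpow hx hy).trans ?_
  gcongr
  exact h

theorem holderOnWith_invFunOn_codeMarkov :
    HolderOnWith (14 * (9 ^ 18) ^ (5 / 19 : ℝ)) (5 / 19)
      (Function.invFunOn codeMarkov (Ico 0 1)) (codeMarkov '' Ico 0 1) := by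
  intro u hu v hv
  have hx := Function.invFunOn_mem hu
  have hy := Function.invFunOn_mem hv
  have h := abs_sub_le_codeMarkov hx hy
  rw [Function.invFunOn_eq hu, Function.invFunOn_eq hv] at h
  rw [edist_dist, edist_dist, Real.dist_eq, Real.dist_eq,
    ENNReal.ofReal_rpow_of_nonneg (abs_nonneg _) (by positivity),
    ← ENNReal.ofReal_coe_nnreal, ← ENNReal.ofReal_mul (by positivity)]
  refine ENNReal.ofReal_le_ofReal ?_
  push_cast
  exact h

theorem image_invFunOn_codeMarkov :
    Function.invFunOn codeMarkov (Ico 0 1) '' (codeMarkov '' Ico 0 1) = Ico 0 1 := by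
  refine InjOn.invFunOn_image (fun x hx y hy hxy => ?_) Subset.rfl
  have h := abs_sub_le_codeMarkov hx hy
  rw [hxy, sub_self, abs_zero, Real.zero_rpow (by norm_num), mul_zero] at h
  linarith [abs_nonpos_iff.1 h]

theorem le_dimH_image_codeMarkov : 5 / 19 ≤ dimH (codeMarkov '' Ico 0 1) := by
  have h := holderOnWith_invFunOn_codeMarkov.dimH_image_le (by norm_num)
  rw [image_invFunOn_codeMarkov,
    Real.dimH_of_nonempty_interior (by rw [interior_Ico]; simp)] at h
  rw [ENNReal.le_div_iff_mul_le (by simp) (Or.inl ENNReal.coe_ne_top)] at h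
  simpa using h

/-- `HD((M \ L) ∩ (c_∞, C_∞)) > 0.2628`. -/
theorem hd_gt :
    ENNReal.ofReal 0.2628 <
      dimH ((MarkovSpectrum \ LagrangeSpectrum) ∩ Ioo cInf CInf) := by
  have hsub : codeMarkov '' Ico 0 1 ⊆ (MarkovSpectrum \ LagrangeSpectrum) ∩ Ioo cInf CInf := by
    rintro _ ⟨y, -, rfl⟩
    exact lam_markovSeq_zero_mem_spectrum (isLabelling_codeSeq _) (codeSeq_zero y)
  refine lt_of_lt_of_le ?_ (le_dimH_image_codeMarkov.trans (dimH_mono hsub))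
  have h : (5 / 19 : ENNReal) = ENNReal.ofReal (5 / 19) := by
    rw [ENNReal.ofReal_div_of_pos (by norm_num)]
    norm_num
  rw [h]
  exact (ENNReal.ofReal_lt_ofReal_iff (by norm_num)).2 (by norm_num)
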